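/- For every t ∈ ℝ, t·Φ(t) + φ(t) > 0. Consequently, for any a, μ ∈ ℝ and σ > 0, the closed-form expected improvement (a − μ)·Φ((a − μ)/σ) + σ·φ((a − μ)/σ) is strictly positive; in particular, the expected improvement acquisition function with σ(x) > 0 is always positive. -/

import Mathlib

open MeasureTheory ProbabilityTheory Real

/-- The density of the standard normal distribution on `ℝ`. -/
noncomputable def stdNormalPDF (z : ℝ) : ℝ :=
  (Real.sqrt (2 * Real.pi))⁻¹ * Real.exp (-z ^ 2 / 2)

/-- The cumulative distribution function of the standard normal distribution. -/
noncomputable def stdNormalCDF (t : ℝ) : ℝ :=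
  ∫ z in Set.Iic t, stdNormalPDF z

theorem stdNormalPDF_pos (z : ℝ) : 0 < stdNormalPDF z := by
  unfold stdNormalPDF
  positivity

theorem integrable_stdNormalPDF : Integrable stdNormalPDF := by
  have h := (integrable_exp_neg_mul_sq (b := 1 / 2) (by norm_num)).const_mul
    (Real.sqrt (2 * Real.pi))⁻¹
  refine h.congr (.of_forall fun z => ?_)
  simp only [stdNormalPDF]
  ring_nf

theorem integrable_mul_stdNormalPDF : Integrable fun z => z * stdNormalPDF z := by
  have h := (integrable_mul_exp_neg_mul_sq (b := 1 / 2) (by norm_num)).const_mul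
    (Real.sqrt (2 * Real.pi))⁻¹
  refine h.congr (.of_forall fun z => ?_)
  simp only [stdNormalPDF]
  ring_nf

theorem hasDerivAt_stdNormalPDF (z : ℝ) :
    HasDerivAt stdNormalPDF (-(z * stdNormalPDF z)) z := by
  have h : HasDerivAt (fun z : ℝ => -z ^ 2 / 2) (-z) z :=
    (((hasDerivAt_id' z).pow 2).neg.div_const 2).congr_deriv (by norm_num; ring)
  refine (h.exp.const_mul (Real.sqrt (2 * Real.pi))⁻¹).congr_deriv ?_
  simp only [stdNormalPDF]
  ring

theorem setIntegral_Iic_mul_stdNormalPDF (t : ℝ) :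
    ∫ z in Set.Iic t, z * stdNormalPDF z = -stdNormalPDF t := by
  have hint : IntegrableOn (fun z => -(z * stdNormalPDF z)) (Set.Iic t) :=
    integrable_mul_stdNormalPDF.neg.integrableOn
  have hlim : Filter.Tendsto stdNormalPDF Filter.atBot (nhds 0) :=
    tendsto_zero_of_hasDerivAt_of_integrableOn_Iic (a := t)
      (fun z _ => hasDerivAt_stdNormalPDF z) hint integrable_stdNormalPDF.integrableOn
  have h := integral_Iic_of_hasDerivAt_of_tendsto' (fun z _ => hasDerivAt_stdNormalPDF z) hint hlim
  rw [integral_neg, sub_zero] at h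
  linarith

theorem setIntegral_Iic_sub_mul_stdNormalPDF (t : ℝ) :
    ∫ z in Set.Iic t, (t - z) * stdNormalPDF z = t * stdNormalCDF t + stdNormalPDF t := by
  simp only [sub_mul]
  rw [integral_sub (integrable_stdNormalPDF.const_mul t).integrableOn
    integrable_mul_stdNormalPDF.integrableOn, integral_const_mul,
    setIntegral_Iic_mul_stdNormalPDF, stdNormalCDF, sub_neg_eq_add]

theorem mul_stdNormalCDF_add_stdNormalPDF_pos (t : ℝ) :
    0 < t * stdNormalCDF t + stdNormalPDF t := by
  have hint : IntegrableOn (fun z => (t - z) * stdNormalPDF z) (Set.Iic t) := by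
    simp only [sub_mul]
    exact ((integrable_stdNormalPDF.const_mul t).sub integrable_mul_stdNormalPDF).integrableOn
  rw [← setIntegral_Iic_sub_mul_stdNormalPDF, setIntegral_pos_iff_support_of_nonneg_ae _ hint]
  · have hsub : Set.Iio t ⊆ Function.support (fun z => (t - z) * stdNormalPDF z) ∩ Set.Iic t :=
      fun z hz => ⟨(mul_pos (sub_pos.2 hz) (stdNormalPDF_pos z)).ne', Set.Iio_subset_Iic_self hz⟩
    exact lt_of_lt_of_le (by simp) (measure_mono hsub)
  · filter_upwards [ae_restrict_mem measurableSet_Iic] with z hz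
    exact mul_nonneg (sub_nonneg.2 hz) (stdNormalPDF_pos z).le

/-- The closed-form expected improvement is always strictly positive:
`t Φ(t) + φ(t) > 0` for all `t`, hence
`(a - μ) Φ((a - μ)/σ) + σ φ((a - μ)/σ) > 0` whenever `σ > 0`. -/
theorem expected_improvement_pos :
    (∀ t : ℝ, 0 < t * stdNormalCDF t + stdNormalPDF t) ∧
    (∀ a μ σ : ℝ, 0 < σ →
      0 < (a - μ) * stdNormalCDF ((a - μ) / σ) + σ * stdNormalPDF ((a - μ) / σ)) := by
  refine ⟨mul_stdNormalCDF_add_stdNormalPDF_pos, fun a μ σ hσ => ?_⟩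
  have h := mul_pos hσ (mul_stdNormalCDF_add_stdNormalPDF_pos ((a - μ) / σ))
  rwa [mul_add, ← mul_assoc, mul_div_cancel₀ _ hσ.ne'] at h
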